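/- The model-checking problem for CCTLc±1 (the cumulative-semantics counting logic with single atomic constraints, coefficients in {−1,1} and integer constants) is undecidable: with respect to a natural encoding of triples (S,q,Φ) of a finite Kripke structure, a state and a CCTLc±1 formula, the predicate '(ε,q) ⊨_S Φ' (satisfaction with empty history) is not computable. -/

import Mathlib

open scoped Classical

noncomputable section

/-- A Kripke structure over atomic propositions indexed by `ℕ`. -/
structure Kripke (Q : Type) where
  R : Q → Q → Prop
  total : ∀ q, ∃ q', R q q'
  label : Q → ℕ → Prop

/-- An (infinite) run of a Kripke structure. -/
def Kripke.Run {Q : Type} (S : Kripke Q) (ρ : ℕ → Q) : Prop :=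
  ∀ i, S.R (ρ i) (ρ (i + 1))

/-- The strict prefix `ρ(0) ⋯ ρ(n-1)` of a run (`n` states). -/
def runPrefix {Q : Type} (ρ : ℕ → Q) (n : ℕ) : List Q :=
  (List.range n).map ρ

/-- Comparison operators `<, ≤, =, ≥, >`. -/
inductive Cmp where
  | lt | le | eq | ge | gt

def Cmp.eval : Cmp → ℤ → ℤ → Prop
  | .lt, a, b => a < b
  | .le, a, b => a ≤ b
  | .eq, a, b => a = b
  | .ge, a, b => a ≥ b
  | .gt, a, b => a > b

/-- CCTLc±1 formulas: `P | φ∧ψ | ¬φ | N φ | E φ U_C ψ | A φ U_C ψ`, where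
`C = Σᵢ αᵢ·#φᵢ ∼ k` is a single atomic constraint with integer
coefficients (well-formed ones have `αᵢ ∈ {−1,1}`, see `CcForm.PM`). -/
inductive CcForm : Type where
  | atom : ℕ → CcForm
  | and : CcForm → CcForm → CcForm
  | not : CcForm → CcForm
  | now : CcForm → CcForm
  | eu : CcForm → List (ℤ × CcForm) → Cmp → ℤ → CcForm → CcForm
  | au : CcForm → List (ℤ × CcForm) → Cmp → ℤ → CcForm → CcForm

mutual
/-- Cumulative satisfaction `(π,q) ⊨ φ`: `π` is the accumulated history. -/
def ccsat {Q : Type} (S : Kripke Q) : CcForm → List Q → Q → Prop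
  | .atom p, _, q => S.label q p
  | .and φ ψ, π, q => ccsat S φ π q ∧ ccsat S ψ π q
  | .not φ, π, q => ¬ ccsat S φ π q
  | .now φ, _, q => ccsat S φ [] q
  | .eu φ l c k ψ, π, q => ∃ ρ, S.Run ρ ∧ ρ 0 = q ∧
      ∃ i, ccsat S ψ (π ++ runPrefix ρ i) (ρ i) ∧
        c.eval (clsum S l (π ++ runPrefix ρ i)) k ∧
        ∀ j < i, ccsat S φ (π ++ runPrefix ρ j) (ρ j)
  | .au φ l c k ψ, π, q => ∀ ρ, S.Run ρ → ρ 0 = q →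
      ∃ i, ccsat S ψ (π ++ runPrefix ρ i) (ρ i) ∧
        c.eval (clsum S l (π ++ runPrefix ρ i)) k ∧
        ∀ j < i, ccsat S φ (π ++ runPrefix ρ j) (ρ j)
termination_by φ _ _ => (sizeOf φ, 0)

/-- Value `Σᵢ αᵢ·#φᵢ(σ)` of a constraint on the finite prefix `σ`. -/
def clsum {Q : Type} (S : Kripke Q) : List (ℤ × CcForm) → List Q → ℤ
  | [], _ => 0
  | (a, φ) :: t, σ => a * (countH S φ [] σ : ℤ) + clsum S t σ
termination_by l _ => (sizeOf l, 0)

/-- `countH S φ done todo` = number of positions `j` of `todo` such that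
`(done·todo|ⱼ₋₁, todo(j)) ⊨ φ`; thus `countH S φ [] σ = #φ(σ)`. -/
def countH {Q : Type} (S : Kripke Q) (φ : CcForm) : List Q → List Q → ℕ
  | _, [] => 0
  | d, s :: t =>
      (if ccsat S φ d s then 1 else 0) + countH S φ (d ++ [s]) t
termination_by d todo => (sizeOf φ + 1, sizeOf todo)
end

mutual
/-- All constraint coefficients belong to `{−1, 1}` (CCTLc±1). -/
def CcForm.PM : CcForm → Prop
  | .atom _ => True
  | .and φ ψ => φ.PM ∧ ψ.PM
  | .not φ => φ.PM
  | .now φ => φ.PM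
  | .eu φ l _ _ ψ => φ.PM ∧ PML l ∧ ψ.PM
  | .au φ l _ _ ψ => φ.PM ∧ PML l ∧ ψ.PM

def PML : List (ℤ × CcForm) → Prop
  | [] => True
  | (a, φ) :: t => (a = 1 ∨ a = -1) ∧ φ.PM ∧ PML t
end

mutual
/-- A natural (Gödel) encoding of formulas as natural numbers. -/
def encCc : CcForm → ℕ
  | .atom p => Nat.pair 0 p
  | .and φ ψ => Nat.pair 1 (Nat.pair (encCc φ) (encCc ψ))
  | .not φ => Nat.pair 2 (encCc φ)
  | .now φ => Nat.pair 3 (encCc φ)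
  | .eu φ l c k ψ => Nat.pair 4 (Nat.pair (encCc φ) (Nat.pair (encCcL l)
      (Nat.pair (match c with | .lt => 0 | .le => 1 | .eq => 2 | .ge => 3 | .gt => 4)
        (Nat.pair (Encodable.encode k) (encCc ψ)))))
  | .au φ l c k ψ => Nat.pair 5 (Nat.pair (encCc φ) (Nat.pair (encCcL l)
      (Nat.pair (match c with | .lt => 0 | .le => 1 | .eq => 2 | .ge => 3 | .gt => 4)
        (Nat.pair (Encodable.encode k) (encCc ψ)))))

def encCcL : List (ℤ × CcForm) → ℕ
  | [] => 0
  | (a, φ) :: t => Nat.pair (Nat.pair (Encodable.encode a) (encCc φ)) (encCcL t) + 1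
end

/-- A finite presentation of a Kripke structure. -/
structure FinKS where
  n : ℕ
  edges : List (ℕ × ℕ)
  labels : List (ℕ × ℕ)

/-- Totality of the presented transition relation. -/
def FinKS.Total (M : FinKS) : Prop :=
  ∀ q : Fin M.n, ∃ q' : Fin M.n, ((q : ℕ), (q' : ℕ)) ∈ M.edges

/-- The Kripke structure presented by `M`. -/
def FinKS.toKripke (M : FinKS) (h : M.Total) : Kripke (Fin M.n) where
  R a b := ((a : ℕ), (b : ℕ)) ∈ M.edges
  total := h
  label a p := ((a : ℕ), p) ∈ M.labels

/-- A natural encoding of a finite Kripke structure. -/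
def encKS (M : FinKS) : ℕ :=
  Nat.pair M.n (Nat.pair (Encodable.encode M.edges) (Encodable.encode M.labels))

/-- A natural encoding of a model-checking instance `(S, q, Φ)`. -/
def encTriple (M : FinKS) (q : ℕ) (Φ : CcForm) : ℕ :=
  Nat.pair (encKS M) (Nat.pair q (encCc Φ))

/-- Elementary operations on a store of counters. -/
inductive CounterOp where
  | inc : ℕ → CounterOp
  | dec : ℕ → CounterOp
  | zero : ℕ → CounterOp

/-- Effect of an operation; `dec` and `zero` block when the counter is, resp. is not, zero. -/
def CounterOp.Step : CounterOp → (ℕ → ℕ) → (ℕ → ℕ) → Prop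
  | .inc i, s, t => t = Function.update s i (s i + 1)
  | .dec i, s, t => s i ≠ 0 ∧ t = Function.update s i (s i - 1)
  | .zero i, s, t => s i = 0 ∧ t = s

/-- Nondeterministic regular counter programs. -/
inductive CounterProg where
  | skip : CounterProg
  | op : CounterOp → CounterProg
  | seq : CounterProg → CounterProg → CounterProg
  | star : CounterProg → CounterProg

namespace CounterProg

/-- Input-output relation of a program. -/
def Sem : CounterProg → (ℕ → ℕ) → (ℕ → ℕ) → Prop
  | skip, s, t => t = s
  | op a, s, t => a.Step s t
  | seq p q, s, t => ∃ u, p.Sem s u ∧ q.Sem u t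
  | star p, s, t => Relation.ReflTransGen p.Sem s t

/-- Under the precondition `I`, the program `p` deterministically computes the function `F`. -/
def Computes (p : CounterProg) (I : (ℕ → ℕ) → Prop) (F : (ℕ → ℕ) → ℕ → ℕ) : Prop :=
  ∀ s, I s → ∀ t, p.Sem s t ↔ t = F s

theorem computes_skip (I) : skip.Computes I id := fun _ _ _ => Iff.rfl

theorem computes_inc (i : ℕ) (I) :
    (op (.inc i)).Computes I fun s => Function.update s i (s i + 1) := fun _ _ _ => Iff.rfl

theorem Computes.seq {p q : CounterProg} {I J F G} (hp : p.Computes I F) (hq : q.Computes J G)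
    (hJ : ∀ s, I s → J (F s)) : (p.seq q).Computes I fun s => G (F s) := by
  intro s hs t
  constructor
  · rintro ⟨u, hu, ht⟩
    rw [hp s hs] at hu
    subst hu
    exact (hq _ (hJ s hs) t).1 ht
  · intro h
    exact ⟨F s, (hp s hs _).2 rfl, (hq _ (hJ s hs) t).2 h⟩

theorem Computes.congr {p : CounterProg} {I J F G} (hp : p.Computes I F) (hJ : ∀ s, J s → I s)
    (h : ∀ s, J s → F s = G s) : p.Computes J G := by
  intro s hs t
  rw [hp s (hJ s hs), h s hs]

/-- Decrement `i` and run `p` repeatedly until counter `i` is zero. -/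
def whilePos (i : ℕ) (p : CounterProg) : CounterProg :=
  ((op (.dec i)).seq p).star.seq (op (.zero i))

theorem sem_whilePos {i : ℕ} {p : CounterProg} {s t : ℕ → ℕ} :
    (whilePos i p).Sem s t ↔ (s i = 0 ∧ t = s) ∨
      (s i ≠ 0 ∧ ∃ u, p.Sem (Function.update s i (s i - 1)) u ∧ (whilePos i p).Sem u t) := by
  constructor
  · rintro ⟨u, hu, h0, rfl⟩
    change Relation.ReflTransGen _ _ _ at hu
    rcases hu.cases_head with rfl | ⟨v, ⟨w, ⟨hs, rfl⟩, hw⟩, hv⟩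
    · exact .inl ⟨h0, rfl⟩
    · exact .inr ⟨hs, v, hw, _, hv, h0, rfl⟩
  · rintro (⟨h0, rfl⟩ | ⟨hs, u, hu, v, hv, h0, rfl⟩)
    · exact ⟨_, .refl, h0, rfl⟩
    · exact ⟨_, .head ⟨_, ⟨hs, rfl⟩, hu⟩ hv, h0, rfl⟩

theorem Computes.whilePos {i : ℕ} {p : CounterProg} {I J : (ℕ → ℕ) → Prop}
    {B F : (ℕ → ℕ) → ℕ → ℕ} (hp : p.Computes J B)
    (hJ : ∀ s, I s → s i ≠ 0 → J (Function.update s i (s i - 1)))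
    (hI : ∀ s, I s → s i ≠ 0 → I (B (Function.update s i (s i - 1))))
    (hB : ∀ s, I s → s i ≠ 0 → B (Function.update s i (s i - 1)) i < s i)
    (hF : ∀ s, I s → s i ≠ 0 → F (B (Function.update s i (s i - 1))) = F s)
    (h0 : ∀ s, I s → s i = 0 → F s = s) : (whilePos i p).Computes I F := by
  intro s hs t
  induction hn : s i using Nat.strong_induction_on generalizing s with
  | _ n ih =>
    subst hn
    rw [sem_whilePos]
    by_cases hi : s i = 0
    · simp [hi, h0 s hs hi]
    · have := ih _ (hB s hs hi) _ (hI s hs hi) rfl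
      rw [hF s hs hi] at this
      simp only [hi, false_and, false_or, ne_eq, not_false_eq_true, true_and]
      rw [← this]
      constructor
      · rintro ⟨u, hu, ht⟩
        rw [hp _ (hJ s hs hi)] at hu
        exact hu ▸ ht
      · intro ht
        exact ⟨_, (hp _ (hJ s hs hi) _).2 rfl, ht⟩

theorem exists_clear (i : ℕ) :
    ∃ p : CounterProg, p.Computes (fun _ => True) fun s => Function.update s i 0 := by
  refine ⟨_, (computes_skip fun _ => True).whilePos (i := i) ?_ ?_ ?_ ?_ ?_⟩ <;> intro s _ hs
  · trivial
  · trivial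
  · simp; omega
  · simp
  · simp [← hs]

theorem exists_transfer {i j : ℕ} (hij : i ≠ j) :
    ∃ p : CounterProg, p.Computes (fun _ => True)
      fun s => Function.update (Function.update s i 0) j (s j + s i) := by
  refine ⟨_, (computes_inc j fun _ => True).whilePos (i := i) ?_ ?_ ?_ ?_ ?_⟩ <;> intro s _ hs
  · trivial
  · trivial
  · simp [hij]; omega
  · ext k
    simp only [Function.update_apply]
    split_ifs <;> omega
  · ext k
    simp only [Function.update_apply]
    split_ifs <;> simp_all

theorem exists_move {i j : ℕ} (hij : i ≠ j) :
    ∃ p : CounterProg, p.Computes (fun _ => True)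
      fun s => Function.update (Function.update s i 0) j (s i) := by
  obtain ⟨p, hp⟩ := exists_clear j
  obtain ⟨q, hq⟩ := exists_transfer hij
  refine ⟨p.seq q, (hp.seq hq fun _ _ => trivial).congr (fun _ h => h) fun s _ => ?_⟩
  ext k
  simp only [Function.update_apply]
  split_ifs <;> simp_all

theorem exists_copy {i j k : ℕ} (hij : i ≠ j) (hik : i ≠ k) (hjk : j ≠ k) :
    ∃ p : CounterProg, p.Computes (fun s => s j = 0 ∧ s k = 0)
      fun s => Function.update s j (s i) := by
  have h₁ : (CounterProg.whilePos i ((op (.inc j)).seq (op (.inc k)))).Computes (fun _ => True)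
      fun s => Function.update (Function.update (Function.update s i 0) j (s j + s i))
        k (s k + s i) := by
    refine ((computes_inc j fun _ => True).seq (computes_inc k fun _ => True)
      fun _ _ => trivial).whilePos ?_ ?_ ?_ ?_ ?_ <;> intro s _ hs
    · trivial
    · trivial
    · simp [hij, hik]; omega
    · ext l
      simp only [Function.update_apply]
      split_ifs <;> omega
    · ext l
      simp only [Function.update_apply]
      split_ifs <;> simp_all
  obtain ⟨q, hq⟩ := exists_move hik.symm
  refine ⟨_, (h₁.seq hq fun _ _ => trivial).congr (fun _ _ => trivial) fun s hs => ?_⟩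
  ext l
  simp only [Function.update_apply]
  split_ifs <;> simp_all

theorem exists_clear_range (b n : ℕ) :
    ∃ p : CounterProg, p.Computes (fun _ => True)
      fun s j => if b ≤ j ∧ j < b + n then 0 else s j := by
  induction n with
  | zero => exact ⟨skip, (computes_skip _).congr (fun _ h => h) fun s _ => by ext j; simp⟩
  | succ n ih =>
    obtain ⟨p, hp⟩ := ih
    obtain ⟨q, hq⟩ := exists_clear (b + n)
    refine ⟨p.seq q, (hp.seq hq fun _ _ => trivial).congr (fun _ h => h) fun s _ => ?_⟩
    ext j
    simp only [Function.update_apply]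
    split_ifs <;> first | rfl | omega

/-- All counters from `b` on are zero. -/
def ZeroFrom (b : ℕ) (s : ℕ → ℕ) : Prop := ∀ j, b ≤ j → s j = 0

/-- For all choices of input counters below `b`, some program writes the value of `f` to counter
`b`, provided that all counters from `b` on are initially zero. -/
def Computable {n : ℕ} (f : List.Vector ℕ n → ℕ) : Prop :=
  ∀ (b : ℕ) (ins : Fin n → ℕ), (∀ i, ins i < b) → ∃ p : CounterProg,
    p.Computes (ZeroFrom b)
      fun s => Function.update s b (f (List.Vector.ofFn fun i => s (ins i)))

theorem computable_get {n : ℕ} (i : Fin n) : Computable fun v => v.get i := by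
  intro b ins hins
  obtain ⟨p, hp⟩ := exists_copy (i := ins i) (j := b) (k := b + 1)
    (hins i).ne (by have := hins i; omega) (by omega)
  exact ⟨p, hp.congr (fun s hs => ⟨hs _ le_rfl, hs _ (by omega)⟩) fun s _ => by simp⟩

theorem Computable.ofFn {m n : ℕ} {g : Fin n → List.Vector ℕ m → ℕ} (hg : ∀ i, Computable (g i))
    (b : ℕ) (ins : Fin m → ℕ) (hins : ∀ i, ins i < b) (k : ℕ) (hk : k ≤ n) :
    ∃ p : CounterProg, p.Computes (ZeroFrom b) fun s j =>
      if h : b ≤ j ∧ j < b + k then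
        g ⟨j - b, by omega⟩ (List.Vector.ofFn fun i => s (ins i)) else s j := by
  induction k with
  | zero =>
    refine ⟨skip, (computes_skip _).congr (fun _ h => h) fun s _ => ?_⟩
    ext j
    rw [dif_neg (by omega)]
    rfl
  | succ k ih =>
    obtain ⟨p, hp⟩ := ih (by omega)
    obtain ⟨q, hq⟩ := hg ⟨k, hk⟩ (b + k) ins fun i => (hins i).trans_le (by omega)
    refine ⟨p.seq q, (hp.seq hq fun s hs j hj => ?_).congr (fun _ h => h) fun s _ => ?_⟩
    · rw [dif_neg (by omega)]
      exact hs j (by omega)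
    · have hlt : ∀ i, ¬ (b ≤ ins i ∧ ins i < b + k) := fun i => by have := hins i; omega
      ext j
      simp only [Function.update_apply, hlt, dif_neg, not_false_eq_true]
      by_cases hj : j = b + k
      · subst hj
        simp
      · rw [if_neg hj]
        by_cases h : b ≤ j ∧ j < b + k
        · rw [dif_pos h, dif_pos (by omega)]
        · rw [dif_neg h, dif_neg (by omega)]

theorem Computable.comp {m n : ℕ} {f : List.Vector ℕ n → ℕ} {g : Fin n → List.Vector ℕ m → ℕ}
    (hf : Computable f) (hg : ∀ i, Computable (g i)) :
    Computable fun v => f (List.Vector.ofFn fun i => g i v) := by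
  intro b ins hins
  obtain ⟨p, hp⟩ := Computable.ofFn hg (b + 1) ins (fun i => (hins i).trans (by omega)) n le_rfl
  obtain ⟨q, hq⟩ := hf (b + 1 + n) (fun i => b + 1 + i) fun i => by omega
  obtain ⟨r, hr⟩ := exists_move (i := b + 1 + n) (j := b) (by omega)
  obtain ⟨c, hc⟩ := exists_clear_range (b + 1) n
  refine ⟨_, (((hp.seq hq fun s hs j hj => ?_).seq hr fun _ _ => trivial).seq hc
    fun _ _ => trivial).congr (fun s hs j hj => hs j (by omega)) fun s hs => ?_⟩
  · rw [dif_neg (by omega)]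
    exact hs j (by omega)
  · ext j
    have h₁ : ∀ i : Fin n, (b + 1 ≤ b + 1 + (i : ℕ) ∧ b + 1 + (i : ℕ) < b + 1 + n) :=
      fun i => by omega
    simp only [Function.update_apply, h₁, dif_pos, and_self, Nat.add_sub_cancel_left, Fin.eta,
      if_true]
    have := hs j
    split_ifs <;> first | rfl | omega

theorem Computable.prec {n : ℕ} {f : List.Vector ℕ n → ℕ} {g : List.Vector ℕ (n + 2) → ℕ}
    (hf : Computable f) (hg : Computable g) :
    Computable fun v : List.Vector ℕ (n + 1) =>
      v.head.rec (f v.tail) fun y ih => g (y ::ᵥ ih ::ᵥ v.tail) := by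
  intro b ins hins
  obtain ⟨p, hp⟩ := hf b (fun i => ins i.succ) fun i => hins _
  obtain ⟨c, hc⟩ := exists_copy (i := ins 0) (j := b + 2) (k := b + 3)
    (by have := hins 0; omega) (by have := hins 0; omega) (by omega)
  obtain ⟨q, hq⟩ := hg (b + 3) (Fin.cons (b + 1) (Fin.cons b fun i => ins i.succ)) (by
    intro i
    refine Fin.cases (by simp) (fun i => Fin.cases (by simp) (fun i => ?_) i) i
    have := hins i.succ
    simp only [Fin.cons_succ]
    omega)
  obtain ⟨m, hm⟩ := exists_move (i := b + 3) (j := b) (by omega)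
  obtain ⟨z, hz⟩ := exists_clear (b + 1)
  let R : (ℕ → ℕ) → ℕ → ℕ := fun s k =>
    k.rec (f (List.Vector.ofFn fun i => s (ins i.succ)))
      fun y ih => g (y ::ᵥ ih ::ᵥ List.Vector.ofFn fun i => s (ins i.succ))
  have hR : ∀ s t : ℕ → ℕ, (∀ j < b, s j = t j) → R s = R t := by
    intro s t h
    have : (fun i : Fin n => s (ins i.succ)) = fun i => t (ins i.succ) :=
      funext fun i => h _ (hins _)
    simp only [R, this]
  have hlt : ∀ (s : ℕ → ℕ) x i, Function.update s (b + 2) x (ins i) = s (ins i) := fun s x i => by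
    have := hins i
    rw [Function.update_of_ne (by omega)]
  have hbody : ((q.seq m).seq (op (.inc (b + 1)))).Computes (ZeroFrom (b + 3)) fun s =>
      Function.update (Function.update s b
        (g (s (b + 1) ::ᵥ s b ::ᵥ List.Vector.ofFn fun i => s (ins i.succ))))
          (b + 1) (s (b + 1) + 1) := by
    refine ((hq.seq hm fun _ _ => trivial).seq (computes_inc (b + 1) fun _ => True)
      fun _ _ => trivial).congr (fun _ h => h) fun s hs => ?_
    have h3 := hs (b + 3) le_rfl
    ext j
    simp only [Function.update_apply]
    split_ifs <;> first | rfl | omega | simp_all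
  have hloop := hbody.whilePos (i := b + 2) (I := fun s => ZeroFrom (b + 3) s ∧ s b = R s (s (b + 1)))
    (F := fun s => Function.update (Function.update (Function.update s (b + 2) 0)
      (b + 1) (s (b + 1) + s (b + 2))) b (R s (s (b + 1) + s (b + 2)))) ?_ ?_ ?_ ?_ ?_
  · refine ⟨_, (((hp.seq hc fun s hs => ?_).seq hloop fun s hs => ⟨fun j hj => ?_, ?_⟩).seq hz
      fun _ _ => trivial).congr (fun _ h => h) fun s hs => ?_⟩
    · have h2 := hs (b + 2) (by omega)
      have h3 := hs (b + 3) (by omega)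
      simp [h2, h3]
    · have := hs j (by omega)
      simp only [Function.update_apply]
      split_ifs <;> omega
    · have h1 := hs (b + 1) (by omega)
      rw [hR _ s fun j hj => by
        rw [Function.update_of_ne (by omega), Function.update_of_ne (by omega)]]
      simp [Function.update_apply, h1, R]
    · ext j
      have h0 := hins 0
      have h1 := hs (b + 1) (by omega)
      have h2 := hs (b + 2) (by omega)
      rw [hR _ s fun j hj => by
        rw [Function.update_of_ne (by omega), Function.update_of_ne (by omega)]]
      simp only [Function.update_apply]
      have e1 : ins 0 ≠ b := by omega
      simp [h1, R, e1, List.Vector.head_ofFn, List.Vector.tail_ofFn]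
      split_ifs <;> first | rfl | omega | (subst_vars; simp_all)
  · intro s hs hi j hj
    have := hs.1 j hj
    rwa [Function.update_of_ne (by omega)]
  · rintro s ⟨hs, hb⟩ hi
    refine ⟨fun j hj => ?_, ?_⟩
    · have := hs j hj
      simp only [Function.update_apply]
      split_ifs <;> omega
    · rw [hR _ s fun j hj => by
        rw [Function.update_of_ne (by omega), Function.update_of_ne (by omega),
          Function.update_of_ne (by omega)]]
      simp [hlt, hb, R]
  · intro s hs hi
    simp
    omega
  · rintro s ⟨hs, hb⟩ hi
    rw [hR _ s fun j hj => by
        rw [Function.update_of_ne (by omega), Function.update_of_ne (by omega),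
          Function.update_of_ne (by omega)]]
    have e : s (b + 1) + 1 + (s (b + 2) - 1) = s (b + 1) + s (b + 2) := by omega
    ext j
    simp [Function.update_apply, e]
    split_ifs <;> rfl
  · rintro s ⟨hs, hb⟩ hi
    ext j
    simp only [Function.update_apply]
    split_ifs <;> simp_all

theorem computable_of_primrec' {n : ℕ} {f : List.Vector ℕ n → ℕ} (hf : Nat.Primrec' f) :
    Computable f := by
  induction hf with
  | zero =>
    exact fun b _ _ => ⟨skip, (computes_skip _).congr (fun _ h => h) fun s hs => by
      simp [← hs b le_rfl]⟩
  | succ =>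
    intro b ins hins
    obtain ⟨p, hp⟩ := computable_get (0 : Fin 1) b ins hins
    refine ⟨_, (hp.seq (computes_inc b fun _ => True) fun _ _ => trivial).congr
      (fun _ h => h) fun s _ => ?_⟩
    simp [List.Vector.head_ofFn]
  | get i => exact computable_get i
  | comp _ _ _ ihf ihg => exact ihf.comp ihg
  | prec _ _ ihf ihg => exact ihf.prec ihg

/-- Semi-decidability of projections of primitive recursive relations by counter programs. -/
theorem exists_sem_iff {g : ℕ → ℕ → ℕ} (hg : Primrec₂ g) :
    ∃ p : CounterProg, ∀ n,
      (∃ t, p.Sem (Function.update (0 : ℕ → ℕ) 0 n) t) ↔ ∃ k, g n k = 0 := by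
  obtain ⟨p, hp⟩ := computable_of_primrec' (Nat.Primrec'.prim_iff₂.2 hg) 2 (fun i => i)
    fun i => i.2
  have hguess : ∀ s t, (star (op (.inc 1))).Sem s t ↔
      ∃ k, t = Function.update s 1 (s 1 + k) := by
    intro s t
    constructor
    · intro h
      change Relation.ReflTransGen _ s t at h
      induction h with
      | refl => exact ⟨0, by simp⟩
      | tail _ h ih =>
        obtain ⟨k, rfl⟩ := ih
        exact ⟨k + 1, h.trans (by simp [add_assoc])⟩
    · rintro ⟨k, rfl⟩
      change Relation.ReflTransGen _ s _
      induction k with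
      | zero => simpa using Relation.ReflTransGen.refl
      | succ k ih => exact ih.tail (by simp [Sem, CounterOp.Step, add_assoc])
  refine ⟨(star (op (.inc 1))).seq (p.seq (op (.zero 2))), fun n => ?_⟩
  have hzero : ∀ k, ZeroFrom 2
      (Function.update (Function.update (0 : ℕ → ℕ) 0 n) 1
        (Function.update (0 : ℕ → ℕ) 0 n 1 + k)) := by
    intro k j hj
    rw [Function.update_of_ne (by omega), Function.update_of_ne (by omega)]
    rfl
  constructor
  · rintro ⟨t, u, hu, v, hv, h0, rfl⟩
    obtain ⟨k, rfl⟩ := (hguess _ _).1 hu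
    rw [hp _ (hzero k)] at hv
    subst hv
    exact ⟨k, by simpa [List.Vector.head_ofFn, List.Vector.tail_ofFn] using h0⟩
  · rintro ⟨k, hk⟩
    refine ⟨_, _, (hguess _ _).2 ⟨k, rfl⟩, _, (hp _ (hzero k) _).2 rfl, ?_, rfl⟩
    simpa [List.Vector.head_ofFn, List.Vector.tail_ofFn] using hk

end CounterProg

namespace CounterProg

/-- Control flow on continuations, i.e. stacks of programs that remain to be executed. -/
inductive Next : List CounterProg → List CounterProg → Prop
  | halt : Next [] []
  | skip K : Next (skip :: K) K
  | op a K : Next (op a :: K) K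
  | seq p q K : Next (seq p q :: K) (p :: q :: K)
  | exit p K : Next (star p :: K) K
  | loop p K : Next (star p :: K) (p :: star p :: K)

/-- Store transformation performed when leaving a continuation. -/
def Effect : List CounterProg → (ℕ → ℕ) → (ℕ → ℕ) → Prop
  | op a :: _, s, t => a.Step s t
  | _, s, t => t = s

/-- Some execution starting from the given continuation and store empties the continuation. -/
inductive Halts : List CounterProg → (ℕ → ℕ) → Prop
  | nil s : Halts [] s
  | step {K K' s t} : Next K K' → Effect K s t → Halts K' t → Halts K s

theorem Halts.cons {p : CounterProg} {K s t} (h : p.Sem s t) (hK : Halts K t) :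
    Halts (p :: K) s := by
  induction p generalizing K s t with
  | skip => exact .step (.skip K) (t := s) rfl (h ▸ hK)
  | op a => exact .step (.op a K) h hK
  | seq p q ihp ihq =>
    obtain ⟨u, hu, ht⟩ := h
    exact .step (.seq p q K) (t := s) rfl (ihp hu (ihq ht hK))
  | star p ih =>
    change Relation.ReflTransGen _ _ _ at h
    induction h using Relation.ReflTransGen.head_induction_on with
    | refl => exact .step (.exit p K) (t := t) rfl hK
    | @head s u hu _ ih' => exact .step (.loop p K) (t := s) rfl (ih hu ih')

/-- Existence of a terminating execution, according to the input-output relations. -/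
def Terminates : List CounterProg → (ℕ → ℕ) → Prop
  | [], _ => True
  | p :: K, s => ∃ t, p.Sem s t ∧ Terminates K t

theorem Halts.terminates {K s} (h : Halts K s) : Terminates K s := by
  induction h with
  | nil => trivial
  | step hn he _ ih =>
    cases hn with
    | halt => trivial
    | skip => exact ⟨_, rfl, he ▸ ih⟩
    | op => exact ⟨_, he, ih⟩
    | seq =>
      obtain ⟨u, hu, t, ht, hK⟩ := ih
      exact ⟨t, ⟨u, he ▸ hu, ht⟩, hK⟩
    | exit => exact ⟨_, .refl, he ▸ ih⟩
    | loop =>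
      obtain ⟨u, hu, t, ht, hK⟩ := ih
      exact ⟨t, .head (he ▸ hu) ht, hK⟩

theorem halts_singleton {p : CounterProg} {s} : Halts [p] s ↔ ∃ t, p.Sem s t :=
  ⟨fun h => h.terminates.imp fun _ h => h.1, fun ⟨_, h⟩ => .cons h (.nil _)⟩

/-- Continuations reachable from `p :: K`, up to the point where `K` is reached. -/
def conts : CounterProg → List CounterProg → Set (List CounterProg)
  | skip, K => {skip :: K}
  | op a, K => {op a :: K}
  | seq p q, K => insert (seq p q :: K) (p.conts (q :: K) ∪ q.conts K)
  | star p, K => insert (star p :: K) (p.conts (star p :: K))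

theorem finite_conts (p : CounterProg) (K) : (p.conts K).Finite := by
  induction p generalizing K with
  | skip => exact Set.finite_singleton _
  | op => exact Set.finite_singleton _
  | seq p q ihp ihq => exact ((ihp _).union (ihq _)).insert _
  | star p ih => exact (ih _).insert _

theorem cons_mem_conts (p : CounterProg) (K) : p :: K ∈ p.conts K := by
  cases p <;> simp [conts]

theorem Next.mem_conts {p : CounterProg} {K X Y} (h : Next X Y) (hX : X ∈ p.conts K) :
    Y ∈ insert K (p.conts K) := by
  induction p generalizing K with
  | skip => cases hX; cases h; simp
  | op => cases hX; cases h; simp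
  | seq p q ihp ihq =>
    rcases hX with rfl | hX | hX
    · cases h
      simp [conts, cons_mem_conts]
    · rcases ihp hX with rfl | hY
      · simp [conts, cons_mem_conts]
      · simp [conts, hY]
    · rcases ihq hX with rfl | hY
      · simp
      · simp [conts, hY]
  | star p ih =>
    rcases hX with rfl | hX
    · cases h <;> simp [conts, cons_mem_conts]
    · rcases ih hX with rfl | hY
      · simp [conts]
      · simp [conts, hY]

/-- The continuations reachable from `[p]`. -/
def Control (p : CounterProg) : Set (List CounterProg) := insert [] (p.conts [])

instance (p : CounterProg) : Finite p.Control := (p.finite_conts []).insert []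

theorem Next.mem_control {p : CounterProg} {X Y} (h : Next X Y) (hX : X ∈ p.Control) :
    Y ∈ p.Control := by
  rcases hX with rfl | hX
  · cases h
    exact .inl rfl
  · exact h.mem_conts hX

theorem exists_next : ∀ K, ∃ K', Next K K'
  | [] => ⟨_, .halt⟩
  | skip :: K => ⟨_, .skip K⟩
  | op a :: K => ⟨_, .op a K⟩
  | seq p q :: K => ⟨_, .seq p q K⟩
  | star p :: K => ⟨_, .exit p K⟩

/-- The atomic proposition labelling a continuation. -/
def atomOf : List CounterProg → ℕ
  | [] => 0
  | op (.inc i) :: _ => 4 * i + 1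
  | op (.dec i) :: _ => 4 * i + 2
  | op (.zero i) :: _ => 4 * i + 3
  | _ => 4

theorem atomOf_eq_dec {K i} (h : atomOf K = 4 * i + 2) : ∃ K', K = op (.dec i) :: K' := by
  unfold atomOf at h
  split at h <;> first | omega | skip
  rename_i j K'
  obtain rfl : i = j := by omega
  exact ⟨_, rfl⟩

theorem atomOf_eq_zero {K i} (h : atomOf K = 4 * i + 3) : ∃ K', K = op (.zero i) :: K' := by
  unfold atomOf at h
  split at h <;> first | omega | skip
  rename_i j K'
  obtain rfl : i = j := by omega
  exact ⟨_, rfl⟩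

end CounterProg

theorem exists_finKS {Q : Type} [Finite Q] (R : Q → Q → Prop) (hR : ∀ q, ∃ q', R q q')
    (lab : Q → ℕ) : ∃ (M : FinKS) (hM : M.Total) (e : Q ≃ Fin M.n),
      (∀ a b, (M.toKripke hM).R (e a) (e b) ↔ R a b) ∧
      ∀ a P, (M.toKripke hM).label (e a) P ↔ lab a = P := by
  obtain ⟨n, ⟨e⟩⟩ := Finite.exists_equiv_fin Q
  let M : FinKS :=
    { n := n
      edges := ((Finset.univ : Finset (Fin n × Fin n)).toList.filter
        fun x => R (e.symm x.1) (e.symm x.2)).map fun x => (x.1.val, x.2.val)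
      labels := (Finset.univ : Finset (Fin n)).toList.map fun x => (x.val, lab (e.symm x)) }
  have hedge : ∀ a b, ((e a).val, (e b).val) ∈ M.edges ↔ R a b := by
    intro a b
    simp only [M, List.mem_map, List.mem_filter, Finset.mem_toList, Finset.mem_univ, true_and,
      decide_eq_true_eq, Prod.exists, Prod.mk.injEq, Fin.val_inj]
    constructor
    · rintro ⟨_, _, h, rfl, rfl⟩
      simpa using h
    · exact fun h => ⟨e a, e b, by simpa using h, rfl, rfl⟩
  have hM : M.Total := fun q => by
    obtain ⟨b, hb⟩ := hR (e.symm q)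
    exact ⟨e b, by simpa using (hedge _ _).2 hb⟩
  refine ⟨M, hM, e, hedge, fun a P => ?_⟩
  change ((e a).val, P) ∈ M.labels ↔ _
  simp only [M, List.mem_map, Finset.mem_toList, Finset.mem_univ, true_and, Prod.mk.injEq,
    Fin.val_inj]
  constructor
  · rintro ⟨_, rfl, rfl⟩
    simp
  · exact fun h => ⟨e a, rfl, by simpa using h⟩

namespace CcForm

/-- The constant true. -/
def verum : CcForm := .not (.and (.atom 0) (.not (.atom 0)))

/-- The constant false. -/
def falsum : CcForm := .and (.atom 0) (.not (.atom 0))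

/-- The history contains `k` more occurrences of `P` than of `P'`, up to the comparison `c`. -/
def diffTest (P P' : ℕ) (c : Cmp) (k : ℤ) : CcForm :=
  .eu falsum [(1, .atom P), (-1, .atom P')] c k verum

/-- Implication from an atom. -/
def atomImp (P : ℕ) (φ : CcForm) : CcForm := .not (.and (.atom P) (.not φ))

/-- The operation at hand is enabled when the initial store is `s₀`. -/
def enabled (s₀ : ℕ → ℕ) : List CounterProg → CcForm
  | .op (.dec i) :: _ => atomImp (4 * i + 2) (diffTest (4 * i + 2) (4 * i + 1) .lt (s₀ i))
  | .op (.zero i) :: _ => atomImp (4 * i + 3) (diffTest (4 * i + 2) (4 * i + 1) .eq (s₀ i))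
  | _ => verum

/-- The operation at hand is enabled, whichever of the listed continuations we are at. -/
def allEnabled (s₀ : ℕ → ℕ) : List (List CounterProg) → CcForm
  | [] => verum
  | K :: L => .and (enabled s₀ K) (allEnabled s₀ L)

/-- There is an execution from the initial store `s₀` which terminates. -/
def reachesHalt (s₀ : ℕ → ℕ) (L : List (List CounterProg)) : CcForm :=
  .eu (allEnabled s₀ L) [] .eq 0 (.atom 0)

theorem pm_enabled (s₀ K) : (enabled s₀ K).PM := by
  unfold enabled
  split <;> simp [atomImp, diffTest, verum, falsum, PM, PML]

theorem pm_reachesHalt (s₀ L) : (reachesHalt s₀ L).PM := by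
  have : (allEnabled s₀ L).PM := by
    induction L with
    | nil => simp [allEnabled, verum, PM]
    | cons K L ih => exact ⟨pm_enabled s₀ K, ih⟩
  exact ⟨this, trivial, trivial⟩

end CcForm

section Semantics

variable {Q : Type} {S : Kripke Q}

theorem Kripke.exists_run (S : Kripke Q) (q : Q) : ∃ ρ, S.Run ρ ∧ ρ 0 = q := by
  choose next hnext using S.total
  exact ⟨fun n => next^[n] q, fun i => by
    simpa [Function.iterate_succ_apply'] using hnext (next^[i] q), rfl⟩

theorem ccsat_verum (π : List Q) (q : Q) : ccsat S .verum π q := by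
  simp [CcForm.verum, ccsat]

theorem not_ccsat_falsum (π : List Q) (q : Q) : ¬ ccsat S .falsum π q := by
  simp [CcForm.falsum, ccsat]

theorem ccsat_atomImp {P : ℕ} {φ : CcForm} {π : List Q} {q : Q} :
    ccsat S (.atomImp P φ) π q ↔ (S.label q P → ccsat S φ π q) := by
  simp [CcForm.atomImp, ccsat]

theorem countH_atom (P : ℕ) (π τ : List Q) :
    countH S (.atom P) π τ = τ.countP fun q => S.label q P := by
  induction τ generalizing π with
  | nil => simp [countH]
  | cons q τ ih => simp [countH, ccsat, ih, List.countP_cons, add_comm]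

theorem runPrefix_succ (ρ : ℕ → Q) (n : ℕ) :
    runPrefix ρ (n + 1) = ρ 0 :: runPrefix (fun i => ρ (i + 1)) n := by
  simp [runPrefix, List.range_succ_eq_map, Function.comp_def]

theorem ccsat_diffTest {P P' : ℕ} {c : Cmp} {k : ℤ} {π : List Q} {q : Q} :
    ccsat S (.diffTest P P' c k) π q ↔
      c.eval ((π.countP fun q => S.label q P : ℕ) - (π.countP fun q => S.label q P' : ℕ)) k := by
  have hsum : ∀ τ : List Q, clsum S [(1, .atom P), (-1, .atom P')] τ =
      (τ.countP fun q => S.label q P : ℕ) - (τ.countP fun q => S.label q P' : ℕ) := by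
    intro τ
    simp [clsum, countH_atom, sub_eq_add_neg]
  simp only [CcForm.diffTest, ccsat, hsum]
  constructor
  · rintro ⟨ρ, -, -, i, -, hc, hi⟩
    have : i = 0 := by
      by_contra h
      exact not_ccsat_falsum _ _ (hi 0 (Nat.pos_of_ne_zero h))
    subst this
    simpa [runPrefix] using hc
  · intro h
    obtain ⟨ρ, hρ, h0⟩ := S.exists_run q
    exact ⟨ρ, hρ, h0, 0, ccsat_verum _ _, by simpa [runPrefix] using h, by simp⟩

theorem ccsat_eu_unfold {φ ψ : CcForm} {π : List Q} {q : Q} :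
    ccsat S (.eu φ [] .eq 0 ψ) π q ↔ ccsat S ψ π q ∨
      (ccsat S φ π q ∧ ∃ q', S.R q q' ∧ ccsat S (.eu φ [] .eq 0 ψ) (π ++ [q]) q') := by
  simp only [ccsat, clsum, Cmp.eval, true_and]
  constructor
  · rintro ⟨ρ, hρ, rfl, i, hψ, hφ⟩
    cases i with
    | zero => exact .inl (by simpa [runPrefix] using hψ)
    | succ i =>
      refine .inr ⟨by simpa [runPrefix] using hφ 0 (by omega), ρ 1, hρ 0, fun j => ρ (j + 1),
        fun j => hρ _, rfl, i, by simpa [runPrefix_succ] using hψ, fun j hj => ?_⟩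
      simpa [runPrefix_succ] using hφ (j + 1) (by omega)
  · rintro (hψ | ⟨hφ, q', hq', ρ, hρ, rfl, i, hψ, hφ'⟩)
    · obtain ⟨ρ, hρ, rfl⟩ := S.exists_run q
      exact ⟨ρ, hρ, rfl, 0, by simpa [runPrefix] using hψ, by simp⟩
    · refine ⟨fun j => j.casesOn q ρ, fun j => ?_, rfl, i + 1, ?_, fun j hj => ?_⟩
      · cases j with
        | zero => exact hq'
        | succ j => exact hρ j
      · simpa [runPrefix_succ] using hψ
      · cases j with
        | zero => simpa [runPrefix] using hφ
        | succ j => simpa [runPrefix_succ] using hφ' j (by omega)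

theorem ccsat_eu_induction {φ ψ : CcForm} {C : List Q → Q → Prop}
    (h₁ : ∀ π q, ccsat S ψ π q → C π q)
    (h₂ : ∀ π q q', ccsat S φ π q → S.R q q' → C (π ++ [q]) q' → C π q) {π : List Q} {q : Q}
    (h : ccsat S (.eu φ [] .eq 0 ψ) π q) : C π q := by
  simp only [ccsat] at h
  obtain ⟨ρ, hρ, rfl, i, hψ, -, hφ⟩ := h
  induction i generalizing π ρ with
  | zero => exact h₁ _ _ (by simpa [runPrefix] using hψ)
  | succ i ih =>
    refine h₂ _ _ (ρ 1) (by simpa [runPrefix] using hφ 0 (by omega)) (hρ 0)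
      (ih (fun j => ρ (j + 1)) (fun j => hρ _) (by simpa [runPrefix_succ] using hψ)
        fun j hj => ?_)
    simpa [runPrefix_succ] using hφ (j + 1) (by omega)

end Semantics

open CounterProg in
theorem ccsat_reachesHalt {Q : Type} {S : Kripke Q} (κ : Q → List CounterProg)
    (hlab : ∀ q P, S.label q P ↔ atomOf (κ q) = P)
    (hnext : ∀ q q', S.R q q' → Next (κ q) (κ q'))
    (hsucc : ∀ q K, Next (κ q) K → ∃ q', κ q' = K ∧ S.R q q')
    {L : List (List CounterProg)} (hL : ∀ q, κ q ∈ L) (s₀ : ℕ → ℕ) (q : Q) :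
    ccsat S (.reachesHalt s₀ L) [] q ↔ Halts (κ q) s₀ := by
  let cnt : ℕ → List Q → ℕ := fun P π => π.countP fun q => S.label q P
  let Inv : List Q → (ℕ → ℕ) → Prop := fun π s =>
    ∀ i, s i + cnt (4 * i + 2) π = s₀ i + cnt (4 * i + 1) π
  have hnil : ∀ q, S.label q 0 ↔ κ q = [] := by
    intro q
    rw [hlab]
    unfold atomOf
    split <;> simp_all
  have hcnt : ∀ P π q, cnt P (π ++ [q]) = cnt P π + if atomOf (κ q) = P then 1 else 0 := by
    intro P π q
    simp only [cnt, List.countP_append, List.countP_singleton, hlab, decide_eq_true_eq]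
  have hInv : ∀ π q s t, Inv π s → Effect (κ q) s t → Inv (π ++ [q]) t := by
    intro π q s t hs ht i
    have := hs i
    rw [hcnt, hcnt]
    generalize κ q = K at *
    unfold Effect CounterOp.Step at ht
    unfold atomOf
    split at ht
    · split at ht
      · subst ht
        simp only [Function.update_apply]
        split_ifs <;> first | omega | (subst_vars; omega)
      · obtain ⟨h0, rfl⟩ := ht
        simp only [Function.update_apply]
        split_ifs <;> first | omega | (subst_vars; omega)
      · obtain ⟨h0, rfl⟩ := ht
        simp only
        split_ifs <;> omega
    · subst ht
      split <;> first | (simp_all; done) | (split_ifs <;> omega)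
  have hen : ∀ π q s K, Inv π s → (∃ t, Effect (κ q) s t) → ccsat S (.enabled s₀ K) π q := by
    rintro π q s K hs ⟨t, ht⟩
    unfold CcForm.enabled
    split
    · rename_i i _
      refine ccsat_atomImp.2 fun hl => ccsat_diffTest.2 ?_
      obtain ⟨K', hK'⟩ := atomOf_eq_dec ((hlab _ _).1 hl)
      rw [hK'] at ht
      have := hs i
      have := ht.1
      simp only [Cmp.eval, cnt] at *
      omega
    · rename_i i _
      refine ccsat_atomImp.2 fun hl => ccsat_diffTest.2 ?_
      obtain ⟨K', hK'⟩ := atomOf_eq_zero ((hlab _ _).1 hl)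
      rw [hK'] at ht
      have := hs i
      have := ht.1
      simp only [Cmp.eval, cnt] at *
      omega
    · exact ccsat_verum _ _
  have hen' : ∀ π q s, Inv π s → ccsat S (.enabled s₀ (κ q)) π q → ∃ t, Effect (κ q) s t := by
    intro π q s hs h
    unfold CcForm.enabled at h
    unfold Effect CounterOp.Step
    split at h
    · rename_i i _ heq
      have hc := ccsat_diffTest.1 (ccsat_atomImp.1 h ((hlab _ _).2 (by rw [heq, atomOf])))
      have := hs i
      simp only [Cmp.eval, cnt] at hc this
      rw [heq]
      exact ⟨_, by omega, rfl⟩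
    · rename_i i _ heq
      have hc := ccsat_diffTest.1 (ccsat_atomImp.1 h ((hlab _ _).2 (by rw [heq, atomOf])))
      have := hs i
      simp only [Cmp.eval, cnt] at hc this
      rw [heq]
      exact ⟨_, by omega, rfl⟩
    · rename_i h₁ h₂
      generalize κ q = K at h₁ h₂ ⊢
      rcases K with _ | ⟨_ | (i | i | i) | _ | _, K⟩
      · exact ⟨_, rfl⟩
      · exact ⟨_, rfl⟩
      · exact ⟨_, rfl⟩
      · exact (h₁ _ _ rfl).elim
      · exact (h₂ _ _ rfl).elim
      · exact ⟨_, rfl⟩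
      · exact ⟨_, rfl⟩
  have hall : ∀ π q, ccsat S (.allEnabled s₀ L) π q ↔ ∀ K ∈ L, ccsat S (.enabled s₀ K) π q := by
    intro π q
    clear hL
    induction L with
    | nil => simp [CcForm.allEnabled, ccsat_verum]
    | cons K L ih => simp [CcForm.allEnabled, ccsat, ih]
  have hinit : Inv [] s₀ := fun i => by simp [cnt]
  constructor
  · intro h
    refine ccsat_eu_induction (C := fun π q => ∀ s, Inv π s → Halts (κ q) s) ?_ ?_ h s₀ hinit
    · intro π q h s _
      simp only [ccsat, hnil] at h
      exact h ▸ .nil s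
    · intro π q q' hφ hR ih s hs
      obtain ⟨t, ht⟩ := hen' π q s hs ((hall π q).1 hφ _ (hL q))
      exact .step (hnext _ _ hR) ht (ih t (hInv π q s t hs ht))
  · intro h
    suffices ∀ K s, Halts K s → ∀ π q, κ q = K → Inv π s → ccsat S (.reachesHalt s₀ L) π q from
      this _ _ h _ _ rfl hinit
    intro K s h
    induction h with
    | nil s =>
      intro π q hq _
      refine ccsat_eu_unfold.2 (.inl ?_)
      simpa only [ccsat, hnil] using hq
    | step hn he _ ih =>
      rintro π q rfl hs
      obtain ⟨q', rfl, hR⟩ := hsucc q _ hn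
      exact ccsat_eu_unfold.2 (.inr ⟨(hall π q).2 fun K _ => hen π q _ K hs ⟨_, he⟩, q', hR,
        ih _ _ rfl (hInv _ _ _ _ hs he)⟩)

theorem computable_encode_natCast {f : ℕ → ℕ} (hf : Computable f) :
    Computable fun n => Encodable.encode (f n : ℤ) := by
  have h : ∀ m : ℕ, Encodable.encode (m : ℤ) = 2 * m := fun m => rfl
  simp only [h]
  exact (Primrec.nat_mul.comp (.const 2) .id).to_comp.comp hf

theorem Computable.natPair {f g : ℕ → ℕ} (hf : Computable f) (hg : Computable g) :
    Computable fun n => Nat.pair (f n) (g n) :=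
  Primrec₂.natPair.to_comp.comp hf hg

theorem computable_encCc_reachesHalt (L : List (List CounterProg)) :
    Computable fun n => encCc (.reachesHalt (Function.update 0 0 n) L) := by
  have hupd : ∀ i, Computable fun n : ℕ => Function.update (0 : ℕ → ℕ) 0 n i := by
    intro i
    by_cases hi : i = 0
    · subst hi
      simpa using! Computable.id
    · simpa [hi] using Computable.const (α := ℕ) 0
  have htest : ∀ P P' c i,
      Computable fun n => encCc (.diffTest P P' c (Function.update (0 : ℕ → ℕ) 0 n i : ℕ)) := by
    intro P P' c i
    simp only [CcForm.diffTest, encCc]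
    exact (Computable.const _).natPair <| (Computable.const _).natPair <|
      (Computable.const _).natPair <| (Computable.const _).natPair <|
      (computable_encode_natCast (hupd i)).natPair (.const _)
  have henabled : ∀ K, Computable fun n => encCc (.enabled (Function.update 0 0 n) K) := by
    intro K
    unfold CcForm.enabled
    split
    · simp only [CcForm.atomImp, encCc]
      exact (Computable.const _).natPair <| (Computable.const _).natPair <|
        (Computable.const _).natPair <| (Computable.const _).natPair (htest _ _ _ _)
    · simp only [CcForm.atomImp, encCc]
      exact (Computable.const _).natPair <| (Computable.const _).natPair <|
        (Computable.const _).natPair <| (Computable.const _).natPair (htest _ _ _ _)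
    · exact .const _
  have hall : Computable fun n => encCc (.allEnabled (Function.update 0 0 n) L) := by
    induction L with
    | nil => exact .const _
    | cons K L ih =>
      simp only [CcForm.allEnabled, encCc]
      exact (Computable.const _).natPair ((henabled K).natPair ih)
  simp only [CcForm.reachesHalt, encCc]
  exact (Computable.const _).natPair (hall.natPair (.const _))

theorem exists_primrec_halting : ∃ g : ℕ → ℕ → ℕ, Primrec₂ g ∧
    ∀ c : Nat.Partrec.Code, (∃ k, g (Encodable.encode c) k = 0) ↔ (c.eval 0).Dom := by
  let g : ℕ → ℕ → ℕ := fun n k =>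
    bif (Nat.Partrec.Code.evaln k (Denumerable.ofNat Nat.Partrec.Code n) 0).isSome then 0 else 1
  refine ⟨g, ?_, fun c => ?_⟩
  · refine Primrec.cond (Primrec.option_isSome.comp (Nat.Partrec.Code.primrec_evaln.comp
      ((Primrec.snd.pair ((Primrec.ofNat _).comp .fst)).pair (.const 0))))
      (.const 0) (.const 1)
  · have : ∀ k, g (Encodable.encode c) k = 0 ↔ ∃ x, x ∈ Nat.Partrec.Code.evaln k c 0 := by
      intro k
      simp only [g, Denumerable.ofNat_encode]
      cases Nat.Partrec.Code.evaln k c 0 <;> simp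
    simp only [this, Part.dom_iff_mem, Nat.Partrec.Code.evaln_complete]
    exact exists_comm

/-- model checking CCTLc±1 (cumulative semantics, empty
initial history) is undecidable. -/
theorem cctlc_pm_mc_undecidable :
    ¬ ∃ f : ℕ → Bool, Computable f ∧
      ∀ (M : FinKS) (hM : M.Total) (q : Fin M.n) (Φ : CcForm), Φ.PM →
        (f (encTriple M (q : ℕ) Φ) = true ↔
          ccsat (M.toKripke hM) Φ [] q) := by
  rintro ⟨f, hf, h⟩
  obtain ⟨g, hg, hhalt⟩ := exists_primrec_halting
  obtain ⟨p, hp⟩ := CounterProg.exists_sem_iff hg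
  obtain ⟨M, hM, e, hR, hlab⟩ := exists_finKS
    (fun X Y : p.Control => CounterProg.Next X Y)
    (fun X => by
      obtain ⟨K, hK⟩ := CounterProg.exists_next X
      exact ⟨⟨K, hK.mem_control X.2⟩, hK⟩)
    fun X => CounterProg.atomOf X
  let κ : Fin M.n → List CounterProg := fun q => e.symm q
  let L : List (List CounterProg) := (List.finRange M.n).map κ
  let q₀ : Fin M.n := e ⟨[p], .inr (p.cons_mem_conts [])⟩
  have hsat : ∀ n, ccsat (M.toKripke hM) (.reachesHalt (Function.update 0 0 n) L) [] q₀ ↔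
      ∃ k, g n k = 0 := by
    intro n
    rw [ccsat_reachesHalt κ (fun q P => ?_) (fun q q' h => ?_) (fun q K h => ?_) (fun q => ?_),
      ← hp, ← CounterProg.halts_singleton]
    · simp [κ, q₀]
    · simpa using hlab (e.symm q) P
    · exact (hR _ _).1 (by simpa using h)
    · exact ⟨e ⟨K, h.mem_control (e.symm q).2⟩, by simp [κ],
        by simpa using (hR (e.symm q) ⟨K, h.mem_control (e.symm q).2⟩).2 h⟩
    · simp [L]
  refine ComputablePred.halting_problem 0 (ComputablePred.computable_iff.2
    ⟨fun c => f (encTriple M q₀ (.reachesHalt (Function.update 0 0 (Encodable.encode c)) L)),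
      ?_, ?_⟩)
  · exact hf.comp (((Computable.const _).natPair ((Computable.const _).natPair
      (computable_encCc_reachesHalt L))).comp Computable.encode)
  · ext c
    rw [h M hM q₀ _ (CcForm.pm_reachesHalt _ _), hsat, hhalt]
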